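/- Let a, b > 0 with θ = a/b irrational, and let α > π²·min{υ(θ)/b, υ(θ⁻¹)/a}. Then there exist infinitely many positive integers m satisfying (2mπ/a)·tan((π/2)·(mθ⁻¹ − ⌊mθ⁻¹⌋)) < α or (2mπ/b)·tan((π/2)·(mθ − ⌊mθ⌋)) < α. -/

import Mathlib

open Real

/-- The one-sided Markov constant
`υ(θ) := inf {c > 0 : ∃∞ (p,q) ∈ ℤ², q ≠ 0, 0 < θ - p/q < c/q²}`. -/
noncomputable def upsilon (θ : ℝ) : ℝ :=
  sInf {c : ℝ | 0 < c ∧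
    {pq : ℤ × ℤ | pq.2 ≠ 0 ∧ 0 < θ - (pq.1 : ℝ) / (pq.2 : ℝ) ∧
      θ - (pq.1 : ℝ) / (pq.2 : ℝ) < c / (pq.2 : ℝ) ^ 2}.Infinite}

/-- Dirichlet approximation from below: an irrational number has lower approximations `s / r`
with `r * θ - s` arbitrarily small and less than `1 / r`. -/
theorem exists_lower_approx_lt {θ ε : ℝ} (hθ : Irrational θ) (hε : 0 < ε) :
    ∃ r s : ℤ, 0 < r ∧ 0 < r * θ - s ∧ r * θ - s < ε ∧ r * (r * θ - s) < 1 := by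
  obtain ⟨n, hn⟩ := exists_nat_one_div_lt hε
  have hn0 : (0 : ℝ) < n + 1 := by positivity
  obtain ⟨x, hx, hxn⟩ := Real.exists_rat_abs_sub_le_and_den_le θ (Nat.succ_pos n)
  have hq : (0 : ℝ) < x.den := by exact_mod_cast x.pos
  have hqn : (x.den : ℝ) ≤ n + 1 := by exact_mod_cast hxn
  have hxq : (x : ℝ) = x.num / x.den := Rat.cast_def x
  have hbound : |x.den * θ - x.num| ≤ 1 / (n + 1 + 1) := by
    have h : x.den * θ - x.num = x.den * (θ - x) := by rw [hxq]; field_simp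
    rw [h, abs_mul, abs_of_pos hq]
    calc x.den * |θ - x| ≤ x.den * (1 / (((n.succ : ℕ) + 1) * x.den)) := by gcongr
      _ = 1 / (n + 1 + 1) := by push_cast; field_simp
  have hsmall : 1 / ((n : ℝ) + 1 + 1) < ε :=
    (one_div_lt_one_div_of_lt hn0 (by linarith)).trans hn
  have hne : x.den * θ - x.num ≠ 0 := by
    intro h
    apply hθ.ne_rat x
    rw [hxq]
    field_simp
    linarith
  obtain hneg | hpos := lt_or_gt_of_ne hne
  · set δ : ℝ := x.num - x.den * θ with hδ
    have hδ0 : 0 < δ := by linarith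
    have hδn : δ * (n + 1 + 1) ≤ 1 := by
      rw [abs_of_neg hneg] at hbound
      rw [← le_div_iff₀ (by positivity)]
      linarith
    have hδε : δ < ε := lt_of_le_of_lt ((le_div_iff₀ (by positivity)).2 hδn) hsmall
    -- Bézout coefficients, shifted so that `r` is just below `1 / δ`
    obtain ⟨u, v, huv⟩ : IsCoprime x.num (x.den : ℤ) := by
      rw [Int.isCoprime_iff_gcd_eq_one]
      exact x.reduced
    obtain ⟨t, ⟨ht1, ht2⟩, -⟩ := existsUnique_add_zsmul_mem_Ico hq (u : ℝ) (1 / δ - x.den)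
    rw [zsmul_eq_mul] at ht1 ht2
    have hr1 : δ * (u + t * x.den) < 1 := by
      rw [mul_comm, ← lt_div_iff₀ hδ0]; linarith
    have hr2 : 1 - δ * (u + t * x.den) ≤ δ * x.den := by
      have : 1 / δ * δ = 1 := by field_simp
      nlinarith
    have hr0 : (0 : ℝ) < u + t * x.den := by nlinarith
    have hval : (u + t * x.den) * θ - (-v + t * x.num) = (1 - δ * (u + t * x.den)) / x.den := by
      have huv' : (u : ℝ) * x.num + v * x.den = 1 := by exact_mod_cast huv
      rw [eq_div_iff hq.ne', hδ]
      linear_combination huv'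
    have hle : (u + t * x.den) * θ - (-v + t * x.num) ≤ δ := by
      rw [hval, div_le_iff₀ hq]; exact hr2
    refine ⟨u + t * x.den, -v + t * x.num, by exact_mod_cast hr0, ?_, ?_, ?_⟩ <;> push_cast
    · rw [hval]
      exact div_pos (by linarith) hq
    · linarith
    · nlinarith
  · rw [abs_of_pos hpos] at hbound
    refine ⟨x.den, x.num, by exact_mod_cast x.pos, ?_, ?_, ?_⟩ <;> push_cast
    · exact hpos
    · linarith
    · rw [le_div_iff₀ (by positivity)] at hbound
      nlinarith

/-- For positive `q`, the approximation quality in terms of `q * θ - p`. -/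
theorem sub_div_lt_div_sq_iff {θ c p q : ℝ} (hq : 0 < q) :
    θ - p / q < c / q ^ 2 ↔ q * (q * θ - p) < c := by
  rw [lt_div_iff₀ (by positivity)]
  have : (θ - p / q) * q ^ 2 = q * (q * θ - p) := by field_simp
  rw [this]

theorem infinite_lower_approx {θ : ℝ} (hθ : Irrational θ) :
    {pq : ℤ × ℤ | pq.2 ≠ 0 ∧ 0 < θ - (pq.1 : ℝ) / (pq.2 : ℝ) ∧
      θ - (pq.1 : ℝ) / (pq.2 : ℝ) < 1 / (pq.2 : ℝ) ^ 2}.Infinite := by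
  set S := {pq : ℤ × ℤ | pq.2 ≠ 0 ∧ 0 < θ - (pq.1 : ℝ) / (pq.2 : ℝ) ∧
      θ - (pq.1 : ℝ) / (pq.2 : ℝ) < 1 / (pq.2 : ℝ) ^ 2}
  have key : ∀ ε > 0, ∃ pq ∈ S, |pq.2 * θ - pq.1| < ε := by
    intro ε hε
    obtain ⟨r, s, hr, h0, hlt, h1⟩ := exists_lower_approx_lt hθ hε
    have hr' : (0 : ℝ) < r := by exact_mod_cast hr
    refine ⟨(s, r), ⟨hr.ne', ?_, (sub_div_lt_div_sq_iff hr').2 h1⟩, by rwa [abs_of_pos h0]⟩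
    rw [sub_pos, div_lt_iff₀ hr']
    linarith
  intro hfin
  obtain ⟨y, hy, -⟩ := key 1 one_pos
  obtain ⟨z, hz, hmin⟩ := Set.exists_min_image S (fun pq => |pq.2 * θ - pq.1|) hfin ⟨y, hy⟩
  obtain ⟨w, hw, hlt⟩ := key |z.2 * θ - z.1| <| by
    refine abs_pos.2 fun h => ?_
    have hz0 : (z.2 : ℝ) ≠ 0 := by exact_mod_cast hz.1
    refine hz.2.1.ne' ?_
    field_simp
    linarith
  exact (hmin w hw).not_gt hlt

/-- Infinitely many lower approximations have unbounded denominators, which may be taken positive. -/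
theorem exists_lower_approx_denom_gt {θ c : ℝ}
    (h : {pq : ℤ × ℤ | pq.2 ≠ 0 ∧ 0 < θ - (pq.1 : ℝ) / (pq.2 : ℝ) ∧
      θ - (pq.1 : ℝ) / (pq.2 : ℝ) < c / (pq.2 : ℝ) ^ 2}.Infinite) (N : ℕ) :
    ∃ m : ℕ, N < m ∧ ∃ p : ℤ, 0 < m * θ - p ∧ m * (m * θ - p) < c := by
  by_contra! hN
  refine h (((Set.finite_Icc (-⌈N * |θ| + c⌉) ⌈N * |θ| + c⌉).prod
    (Set.finite_Icc (-(N : ℤ)) N)).subset ?_)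
  rintro ⟨p, q⟩ ⟨hq0, hpos, hlt⟩
  dsimp only at hq0 hpos hlt
  -- normalise the sign of the denominator
  obtain ⟨m, p', hm, hmq, hp, hpos', hlt'⟩ : ∃ (m : ℕ) (p' : ℤ), 0 < m ∧ (m : ℤ) = |q| ∧
      |p'| = |p| ∧ 0 < m * θ - p' ∧ m * (m * θ - p') < c := by
    have hm : (0 : ℤ) < q.natAbs := by exact_mod_cast Int.natAbs_pos.2 hq0
    have hm' : (0 : ℝ) < (q.natAbs : ℝ) := by exact_mod_cast hm
    obtain ⟨p', hp, hdiv⟩ : ∃ p' : ℤ, |p'| = |p| ∧ (p : ℝ) / q = p' / (q.natAbs : ℝ) := by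
      rcases Int.natAbs_eq q with hq | hq
      · exact ⟨p, rfl, by rw [hq]; simp⟩
      · refine ⟨-p, abs_neg p, ?_⟩
        rw [hq]
        push_cast [Int.natAbs_neg, Int.natAbs_natCast]
        rw [div_neg, neg_div]
        simp
    have hsq : (q : ℝ) ^ 2 = (q.natAbs : ℝ) ^ 2 := by
      rw [Nat.cast_natAbs, Int.cast_abs, sq_abs]
    rw [hdiv] at hpos hlt
    rw [hsq] at hlt
    refine ⟨q.natAbs, p', by exact_mod_cast hm, Int.natCast_natAbs q, hp, ?_,
      (sub_div_lt_div_sq_iff hm').1 hlt⟩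
    rw [sub_pos, div_lt_iff₀ hm'] at hpos
    linarith
  have hmN : m ≤ N := by
    by_contra! hlt
    exact (hN m hlt p' hpos').not_gt hlt'
  have hmNR : (m : ℝ) ≤ N := by exact_mod_cast hmN
  have hm1 : (1 : ℝ) ≤ m := by exact_mod_cast hm
  have hp_le : |(p' : ℝ)| ≤ N * |θ| + c := by
    have hd : m * θ - p' < c := by nlinarith
    calc |(p' : ℝ)| = |m * θ - (m * θ - p')| := by congr 1; ring
      _ ≤ |m * θ| + |m * θ - p'| := abs_sub _ _
      _ = m * |θ| + (m * θ - p') := by rw [abs_mul, abs_of_pos hpos', Nat.abs_cast]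
      _ ≤ N * |θ| + c := by gcongr
  have hp_int : |p| ≤ ⌈N * |θ| + c⌉ := by
    rw [← hp]
    have := hp_le.trans (Int.le_ceil _)
    exact_mod_cast this
  exact ⟨abs_le.1 hp_int, abs_le.1 (by rw [← hmq]; exact_mod_cast hmN)⟩

theorem exists_tan_lt_mul {K : ℝ} (hK : 1 < K) :
    ∃ δ > 0, ∀ y, 0 < y → y < δ → tan y < K * y := by
  have hd : HasDerivAt tan 1 0 := by
    simpa using Real.hasDerivAt_tan (x := 0) (by simp)
  have h := (hasDerivAt_iff_tendsto_slope.1 hd).eventually (gt_mem_nhds hK)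
  rw [eventually_nhdsWithin_iff, Metric.eventually_nhds_iff] at h
  obtain ⟨δ, hδ, h⟩ := h
  refine ⟨δ, hδ, fun y hy hyδ => ?_⟩
  have := h (y := y) (by simpa [abs_of_pos hy] using hyδ) (by simpa using hy.ne')
  rwa [slope_def_field, tan_zero, sub_zero, sub_zero, div_lt_iff₀ hy] at this

theorem infinite_gap_condition {θ d α : ℝ} (hθ : Irrational θ) (hd : 0 < d)
    (hα : π ^ 2 * (upsilon θ / d) < α) :
    {m : ℕ | 0 < m ∧
      (2 * m * π / d) * Real.tan (π / 2 * ((m : ℝ) * θ - ⌊(m : ℝ) * θ⌋)) < α}.Infinite := by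
  have hπ := Real.pi_pos
  have hlt : upsilon θ < α * d / π ^ 2 := by
    rw [lt_div_iff₀ (by positivity)]
    calc upsilon θ * π ^ 2 = π ^ 2 * (upsilon θ / d) * d := by field_simp
      _ < α * d := by gcongr
  unfold upsilon at hlt
  obtain ⟨c, ⟨hc, hinf⟩, hcα⟩ :=
    exists_lt_of_csInf_lt (by exact ⟨1, one_pos, infinite_lower_approx hθ⟩) hlt
  have hK : 1 < α * d / π ^ 2 / c := (one_lt_div hc).2 hcα
  obtain ⟨δ, hδ, htan⟩ := exists_tan_lt_mul hK
  refine Set.infinite_of_forall_exists_gt fun N => ?_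
  obtain ⟨m, hm, p, hpos, hmc⟩ :=
    exists_lower_approx_denom_gt hinf (max N (max ⌈c⌉₊ ⌈π / 2 * c / δ⌉₊))
  simp only [max_lt_iff, Nat.lt_iff_add_one_le] at hm
  obtain ⟨hmN, hmc1, hmδ⟩ := hm
  have hm0 : (0 : ℝ) < m := by exact_mod_cast (Nat.succ_pos N).trans_le hmN
  have hcm : c < m := (Nat.le_ceil c).trans_lt (by exact_mod_cast hmc1)
  have hδm : π / 2 * c / δ < m := (Nat.le_ceil _).trans_lt (by exact_mod_cast hmδ)
  have hfloor : ⌊(m : ℝ) * θ⌋ = p := by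
    rw [Int.floor_eq_iff]
    constructor <;> nlinarith
  refine ⟨m, ⟨by exact_mod_cast hm0, ?_⟩, hmN⟩
  rw [hfloor]
  have hy : π / 2 * (m * θ - p) < δ := by
    rw [div_lt_iff₀ hδ] at hδm
    have : m * (π / 2 * (m * θ - p)) < m * δ := by
      calc m * (π / 2 * (m * θ - p)) = π / 2 * (m * (m * θ - p)) := by ring
        _ < π / 2 * c := by gcongr
        _ < m * δ := hδm
    exact lt_of_mul_lt_mul_left this hm0.le
  have hα0 : 0 < α * d / π ^ 2 / c := by linarith
  calc 2 * m * π / d * tan (π / 2 * (m * θ - p))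
      < 2 * m * π / d * (α * d / π ^ 2 / c * (π / 2 * (m * θ - p))) := by
        gcongr
        exact htan _ (by positivity) hy
    _ = π ^ 2 / d * (α * d / π ^ 2 / c) * (m * (m * θ - p)) := by field_simp
    _ < π ^ 2 / d * (α * d / π ^ 2 / c) * c := by gcongr
    _ = α := by field_simp

theorem infinitely_many_gaps_of_large_alpha (a b α : ℝ) (ha : 0 < a) (hb : 0 < b)
    (hirr : Irrational (a / b))
    (hα : π ^ 2 * min (upsilon (a / b) / b) (upsilon (a / b)⁻¹ / a) < α) :
    {m : ℕ | 0 < m ∧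
        ((2 * m * π / a) * Real.tan (π / 2 *
            ((m : ℝ) * (a / b)⁻¹ - ⌊(m : ℝ) * (a / b)⁻¹⌋)) < α ∨
          (2 * m * π / b) * Real.tan (π / 2 *
            ((m : ℝ) * (a / b) - ⌊(m : ℝ) * (a / b)⌋)) < α)}.Infinite := by
  rcases min_choice (upsilon (a / b) / b) (upsilon (a / b)⁻¹ / a) with h | h <;> rw [h] at hα
  · exact (infinite_gap_condition hirr hb hα).mono fun m hm => ⟨hm.1, Or.inr hm.2⟩
  · exact (infinite_gap_condition hirr.inv ha hα).mono fun m hm => ⟨hm.1, Or.inl hm.2⟩
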